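/- For every 0 < M̄ ≤ M, the infima satisfy the scaling inequality h_{M̄}^r ≥ (M̄/M)^{5/3} h_M^r. -/

import Mathlib

open MeasureTheory Real Filter Topology

noncomputable section

abbrev Space : Type := EuclideanSpace ℝ (Fin 3)

/-- Induced gravitational potential `U_ρ = -ρ ∗ 1/|·|`. -/
def Upot (ρ : Space → ℝ) : Space → ℝ := fun x => - ∫ y : Space, ρ y / ‖x - y‖

/-- Induced gravitational field `∇U_ρ`. -/
def gradU (ρ : Space → ℝ) : Space → Space := fun x => gradient (Upot ρ) x

/-- Potential energy. -/
def Epot (ρ : Space → ℝ) : ℝ :=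
  -(1/2) * ∫ x : Space, ∫ y : Space, ρ x * ρ y / ‖x - y‖

/-- The reduced energy-Casimir functional `H_C^r(ρ) = ∫ Φ(ρ) + E_pot(ρ)`. -/
def HCr (Φ : ℝ → ℝ) (ρ : Space → ℝ) : ℝ := (∫ x : Space, Φ (ρ x)) + Epot ρ

/-- The reduced constraint set `F_M^r = {ρ ∈ L¹₊ : ∫ Φ(ρ) < ∞, ∫ ρ = M}`. -/
def FMr (Φ : ℝ → ℝ) (M : ℝ) : Set (Space → ℝ) :=
  {ρ | (∀ x, 0 ≤ ρ x) ∧ Integrable ρ ∧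
       Integrable (fun x => Φ (ρ x)) ∧ (∫ x : Space, ρ x) = M}

/-- The infimum `h_M^r` of `H_C^r` over `F_M^r`. -/
def hMr (Φ : ℝ → ℝ) (M : ℝ) : ℝ := sInf (HCr Φ '' FMr Φ M)

/-- Assumptions on `Φ`: `Φ ∈ C¹([0,∞))` with derivative `Φ'`, `Φ(0) = Φ'(0) = 0`,
strictly convex, `Φ(r) ≥ C r^{1+1/n}` for large `r` with `0 < n < 3`, and
`Φ(r) ≤ C r^{1+1/n'}` for small `r` with `0 < n' < 3`. -/
structure PhiHyp (Φ Φ' : ℝ → ℝ) (n n' : ℝ) : Prop where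
  n_pos : 0 < n
  n_lt_three : n < 3
  n'_pos : 0 < n'
  n'_lt_three : n' < 3
  hasDeriv : ∀ r ∈ Set.Ici (0:ℝ), HasDerivWithinAt Φ (Φ' r) (Set.Ici 0) r
  contDeriv : ContinuousOn Φ' (Set.Ici 0)
  zero : Φ 0 = 0
  derivZero : Φ' 0 = 0
  strictConvex : StrictConvexOn ℝ (Set.Ici 0) Φ
  growth : ∃ C > (0:ℝ), ∃ r₁ : ℝ, ∀ r : ℝ, r₁ ≤ r → C * r ^ (1 + 1/n) ≤ Φ r
  small : ∃ C > (0:ℝ), ∃ r₁ > (0:ℝ), ∀ r : ℝ, 0 ≤ r → r ≤ r₁ → Φ r ≤ C * r ^ (1 + 1/n')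

/-- The Newtonian kernel truncated to the ball of radius `r` has integral at most `K r²`. -/
lemma exists_lintegral_truncated_kernel_le :
    ∃ K : ℝ, 0 ≤ K ∧ ∀ r : ℝ, 0 < r →
      ∫⁻ z : Space, ENNReal.ofReal ((Set.Iio r).indicator (fun s : ℝ => s⁻¹) ‖z‖)
        ≤ ENNReal.ofReal (K * r ^ 2) := by
  have hint : Integrable
      (fun z : Space => (Set.Iio (1:ℝ)).indicator (fun s : ℝ => s⁻¹) ‖z‖) := by
    have h : IntegrableOn (fun z : Space => (‖z‖)⁻¹) (Metric.ball 0 1) := by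
      rw [integrableOn_fun_norm_addHaar volume (f := fun s : ℝ => s⁻¹)]
      have h2 : IntegrableOn (fun y : ℝ => y) (Set.Ioo 0 1) :=
        (continuous_id.integrableOn_Icc (a := (0:ℝ)) (b := 1)).mono_set Set.Ioo_subset_Icc_self
      refine h2.congr_fun (fun y hy => ?_) measurableSet_Ioo
      have : y ≠ 0 := hy.1.ne'
      simp only [finrank_euclideanSpace, Fintype.card_fin, smul_eq_mul]
      field_simp
    rw [← integrable_indicator_iff Metric.isOpen_ball.measurableSet] at h
    refine h.congr (Eventually.of_forall fun z => ?_)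
    simp [Set.indicator]
  have hnn : ∀ (r : ℝ) (z : Space), 0 ≤ (Set.Iio r).indicator (fun s : ℝ => s⁻¹) ‖z‖ :=
    fun r z => Set.indicator_apply_nonneg fun _ => inv_nonneg.2 (norm_nonneg z)
  refine ⟨∫ z : Space, (Set.Iio (1:ℝ)).indicator (fun s : ℝ => s⁻¹) ‖z‖,
    integral_nonneg (hnn 1), fun r hr => ?_⟩
  have hscale : (fun z : Space => (Set.Iio r).indicator (fun s : ℝ => s⁻¹) ‖z‖) =
      fun z => r⁻¹ * (Set.Iio (1:ℝ)).indicator (fun s : ℝ => s⁻¹) ‖r⁻¹ • z‖ := by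
    funext z
    have hn : ‖r⁻¹ • z‖ = r⁻¹ * ‖z‖ := by
      rw [norm_smul, Real.norm_of_nonneg (inv_nonneg.2 hr.le)]
    have hiff : r⁻¹ * ‖z‖ < 1 ↔ ‖z‖ < r := by
      rw [inv_mul_lt_iff₀ hr, mul_one]
    simp only [hn, Set.indicator, Set.mem_Iio, hiff]
    split_ifs
    · rw [mul_inv, inv_inv, inv_mul_cancel_left₀ hr.ne']
    · simp
  have hr' : r⁻¹ ≠ 0 := inv_ne_zero hr.ne'
  rw [← ofReal_integral_eq_lintegral_ofReal
    (by rw [hscale]; exact (hint.comp_smul hr').const_mul _)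
    (Eventually.of_forall (hnn r)), hscale, integral_const_mul,
    Measure.integral_comp_smul volume
      (fun z : Space => (Set.Iio (1:ℝ)).indicator (fun s : ℝ => s⁻¹) ‖z‖) r⁻¹]
  refine ENNReal.ofReal_le_ofReal (le_of_eq ?_)
  simp only [finrank_euclideanSpace, Fintype.card_fin, smul_eq_mul]
  rw [inv_pow, inv_inv, abs_of_pos (by positivity)]
  field_simp

/-- Potential of a density truncated at height `a`. -/
lemma lintegral_min_mul_kernel_le {K : ℝ} (hK0 : 0 ≤ K)
    (hK : ∀ r : ℝ, 0 < r →
      ∫⁻ z : Space, ENNReal.ofReal ((Set.Iio r).indicator (fun s : ℝ => s⁻¹) ‖z‖)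
        ≤ ENNReal.ofReal (K * r ^ 2))
    {g : Space → ℝ} (hg : Measurable g) (hg0 : ∀ x, 0 ≤ g x) {M : ℝ} (hM : 0 ≤ M)
    (hgM : ∫⁻ x, ENNReal.ofReal (g x) ≤ ENNReal.ofReal M) {a : ℝ} (ha : 0 < a) (x : Space) :
    ∫⁻ y, ENNReal.ofReal (min (g y) a * ‖x - y‖⁻¹)
      ≤ ENNReal.ofReal ((K + M) * a ^ ((1:ℝ)/3)) := by
  set r : ℝ := a ^ (-((1:ℝ)/3)) with hrdef
  have hr : 0 < r := rpow_pos_of_pos ha _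
  have hpt : ∀ y, ENNReal.ofReal (min (g y) a * ‖x - y‖⁻¹) ≤
      ENNReal.ofReal r⁻¹ * ENNReal.ofReal (g y) +
      ENNReal.ofReal a *
        ENNReal.ofReal ((Set.Iio r).indicator (fun s : ℝ => s⁻¹) ‖x - y‖) := by
    intro y
    have hi : 0 ≤ (Set.Iio r).indicator (fun s : ℝ => s⁻¹) ‖x - y‖ :=
      Set.indicator_apply_nonneg fun _ => inv_nonneg.2 (norm_nonneg _)
    have h1 : 0 ≤ r⁻¹ * g y := mul_nonneg (inv_nonneg.2 hr.le) (hg0 y)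
    rw [← ENNReal.ofReal_mul (inv_nonneg.2 hr.le), ← ENNReal.ofReal_mul ha.le,
      ← ENNReal.ofReal_add h1 (mul_nonneg ha.le hi)]
    refine ENNReal.ofReal_le_ofReal ?_
    by_cases h : ‖x - y‖ < r
    · rw [Set.indicator_of_mem (Set.mem_Iio.2 h)]
      have := mul_le_mul_of_nonneg_right (min_le_right (g y) a) (inv_nonneg.2 (norm_nonneg (x - y)))
      linarith
    · rw [Set.indicator_of_notMem (by simpa using h), mul_zero, add_zero, mul_comm]
      push Not at h
      exact mul_le_mul (inv_anti₀ hr h) (min_le_left _ _) (le_min (hg0 y) ha.le)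
        (inv_nonneg.2 hr.le)
  have hshift : ∫⁻ y, ENNReal.ofReal ((Set.Iio r).indicator (fun s : ℝ => s⁻¹) ‖x - y‖)
      = ∫⁻ z : Space, ENNReal.ofReal ((Set.Iio r).indicator (fun s : ℝ => s⁻¹) ‖z‖) :=
    lintegral_sub_left_eq_self
      (fun z : Space => ENNReal.ofReal ((Set.Iio r).indicator (fun s : ℝ => s⁻¹) ‖z‖)) x
  calc
    _ ≤ ∫⁻ y, (ENNReal.ofReal r⁻¹ * ENNReal.ofReal (g y) +
        ENNReal.ofReal a *
          ENNReal.ofReal ((Set.Iio r).indicator (fun s : ℝ => s⁻¹) ‖x - y‖)) :=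
      lintegral_mono hpt
    _ ≤ ENNReal.ofReal r⁻¹ * ENNReal.ofReal M + ENNReal.ofReal a * ENNReal.ofReal (K * r ^ 2) := by
      rw [lintegral_add_left (by fun_prop), lintegral_const_mul' _ _ ENNReal.ofReal_ne_top,
        lintegral_const_mul' _ _ ENNReal.ofReal_ne_top, hshift]
      gcongr
      exact hK r hr
    _ = ENNReal.ofReal ((K + M) * a ^ ((1:ℝ)/3)) := by
      rw [← ENNReal.ofReal_mul (inv_nonneg.2 hr.le), ← ENNReal.ofReal_mul ha.le,
        ← ENNReal.ofReal_add (by positivity) (by positivity)]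
      congr 1
      have e1 : r⁻¹ = a ^ ((1:ℝ)/3) := by rw [hrdef, rpow_neg ha.le, inv_inv]
      have e2 : a * r ^ 2 = a ^ ((1:ℝ)/3) := by
        rw [hrdef, ← rpow_natCast, ← rpow_mul ha.le]
        nth_rewrite 1 [← rpow_one a]
        rw [← rpow_add ha]
        norm_num
      rw [e1, mul_left_comm, e2]
      ring

/-- An elementary Hardy–Littlewood–Sobolev type bound by the mass and the `4/3`-moment. -/
lemma lintegral_lintegral_mul_kernel_le {K : ℝ} (hK0 : 0 ≤ K)
    (hK : ∀ r : ℝ, 0 < r →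
      ∫⁻ z : Space, ENNReal.ofReal ((Set.Iio r).indicator (fun s : ℝ => s⁻¹) ‖z‖)
        ≤ ENNReal.ofReal (K * r ^ 2))
    {g : Space → ℝ} (hg : Measurable g) (hg0 : ∀ x, 0 ≤ g x) {M : ℝ} (hM : 0 ≤ M)
    (hgM : ∫⁻ x, ENNReal.ofReal (g x) ≤ ENNReal.ofReal M) :
    ∫⁻ x, ∫⁻ y, ENNReal.ofReal (g x * g y * ‖x - y‖⁻¹)
      ≤ ENNReal.ofReal (2 * (K + M)) * ∫⁻ x, ENNReal.ofReal (g x ^ ((4:ℝ)/3)) := by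
  set A : Space → Space → ENNReal :=
    fun x y => ENNReal.ofReal (g x * (min (g y) (g x) * ‖x - y‖⁻¹)) with hA
  have hAm : Measurable (Function.uncurry A) := by
    simp only [hA, Function.uncurry_def]
    fun_prop
  have hpt : ∀ x y, ENNReal.ofReal (g x * g y * ‖x - y‖⁻¹) ≤ A x y + A y x := by
    intro x y
    rcases le_total (g y) (g x) with h | h
    · refine le_trans (le_of_eq ?_) le_self_add
      simp only [hA, min_eq_left h, mul_assoc]
    · refine le_trans (le_of_eq ?_) le_add_self
      simp only [hA, min_eq_left h, norm_sub_rev y x]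
      congr 1; ring
  have hAx : ∫⁻ x, ∫⁻ y, A x y
      ≤ ENNReal.ofReal (K + M) * ∫⁻ x, ENNReal.ofReal (g x ^ ((4:ℝ)/3)) := by
    rw [← lintegral_const_mul' _ _ ENNReal.ofReal_ne_top]
    refine lintegral_mono fun x => ?_
    rcases (hg0 x).eq_or_lt with h | h
    · simp [hA, ← h]
    · simp only [hA, ENNReal.ofReal_mul (hg0 x)]
      rw [lintegral_const_mul' _ _ ENNReal.ofReal_ne_top]
      refine (mul_le_mul_right (lintegral_min_mul_kernel_le hK0 hK hg hg0 hM hgM h x) _).trans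
        (le_of_eq ?_)
      rw [← ENNReal.ofReal_mul h.le, ← ENNReal.ofReal_mul (by positivity)]
      congr 1
      have : g x ^ ((4:ℝ)/3) = g x * g x ^ ((1:ℝ)/3) := by
        nth_rewrite 2 [← rpow_one (g x)]
        rw [← rpow_add h]
        norm_num
      rw [this]; ring
  calc
    _ ≤ ∫⁻ x, ∫⁻ y, (A x y + A y x) := lintegral_mono fun x => lintegral_mono (hpt x)
    _ = (∫⁻ x, ∫⁻ y, A x y) + ∫⁻ x, ∫⁻ y, A y x := by
      have hm : Measurable fun x => ∫⁻ y, A x y := hAm.lintegral_prod_right'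
      rw [← lintegral_add_left hm]
      refine lintegral_congr fun x => ?_
      exact lintegral_add_left (hAm.comp measurable_prodMk_left) _
    _ = 2 * ∫⁻ x, ∫⁻ y, A x y := by
      rw [lintegral_lintegral_swap (f := fun x y => A y x)
        (hAm.comp measurable_swap).aemeasurable, two_mul]
    _ ≤ 2 * (ENNReal.ofReal (K + M) * ∫⁻ x, ENNReal.ofReal (g x ^ ((4:ℝ)/3))) := by gcongr
    _ = _ := by
      rw [ENNReal.ofReal_mul (by norm_num), ENNReal.ofReal_ofNat, mul_assoc]

/-- The potential energy is controlled by the mass and any integrable majorant of `ρ^{4/3}`. -/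
lemma exists_abs_Epot_le :
    ∃ K : ℝ, 0 ≤ K ∧ ∀ (ρ h : Space → ℝ), (∀ x, 0 ≤ ρ x) → Integrable ρ → Integrable h →
      (∀ x, ρ x ^ ((4:ℝ)/3) ≤ h x) → |Epot ρ| ≤ (K + ∫ x, ρ x) * ∫ x, h x := by
  obtain ⟨K, hK0, hK⟩ := exists_lintegral_truncated_kernel_le
  refine ⟨K, hK0, fun ρ h hρ0 hρ hh hle => ?_⟩
  have hM : 0 ≤ ∫ x, ρ x := integral_nonneg hρ0
  have hh0 : ∀ x, 0 ≤ h x := fun x => (rpow_nonneg (hρ0 x) _).trans (hle x)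
  have hI : 0 ≤ ∫ x, h x := integral_nonneg hh0
  obtain ⟨g₀, hg₀, hρg₀⟩ := hρ.aemeasurable
  have hρg : ρ =ᵐ[volume] fun x => max (g₀ x) 0 := by
    filter_upwards [hρg₀] with x hx
    rw [← hx, max_eq_left (hρ0 x)]
  have hg : Measurable fun x => max (g₀ x) 0 := hg₀.max measurable_const
  set g : Space → ℝ := fun x => max (g₀ x) 0
  have hg0 : ∀ x, 0 ≤ g x := fun x => le_max_right _ _
  have hgM : ∫⁻ x, ENNReal.ofReal (g x) ≤ ENNReal.ofReal (∫ x, ρ x) := by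
    rw [ofReal_integral_eq_lintegral_ofReal hρ (Eventually.of_forall hρ0)]
    refine le_of_eq (lintegral_congr_ae ?_)
    filter_upwards [hρg] with x hx
    rw [hx]
  have hgh : ∫⁻ x, ENNReal.ofReal (g x ^ ((4:ℝ)/3)) ≤ ENNReal.ofReal (∫ x, h x) := by
    rw [ofReal_integral_eq_lintegral_ofReal hh (Eventually.of_forall hh0)]
    refine lintegral_mono_ae ?_
    filter_upwards [hρg] with x hx
    rw [← hx]
    exact ENNReal.ofReal_le_ofReal (hle x)
  have key : ‖∫ x : Space, ∫ y : Space, ρ x * ρ y / ‖x - y‖‖ₑ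
      ≤ ENNReal.ofReal (2 * (K + ∫ x, ρ x) * ∫ x, h x) := by
    calc
      _ ≤ ∫⁻ x : Space, ‖∫ y : Space, ρ x * ρ y / ‖x - y‖‖ₑ := enorm_integral_le_lintegral_enorm _
      _ ≤ ∫⁻ x : Space, ∫⁻ y : Space, ‖ρ x * ρ y / ‖x - y‖‖ₑ :=
        lintegral_mono fun x => enorm_integral_le_lintegral_enorm _
      _ = ∫⁻ x, ∫⁻ y, ENNReal.ofReal (g x * g y * ‖x - y‖⁻¹) := by
        refine lintegral_congr_ae ?_
        filter_upwards [hρg] with x hx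
        refine lintegral_congr_ae ?_
        filter_upwards [hρg] with y hy
        rw [hx, hy, div_eq_mul_inv]
        exact Real.enorm_eq_ofReal
          (mul_nonneg (mul_nonneg (hg0 x) (hg0 y)) (inv_nonneg.2 (norm_nonneg _)))
      _ ≤ _ := lintegral_lintegral_mul_kernel_le hK0 hK hg hg0 hM hgM
      _ ≤ ENNReal.ofReal (2 * (K + ∫ x, ρ x)) * ENNReal.ofReal (∫ x, h x) := by gcongr
      _ = _ := (ENNReal.ofReal_mul (by positivity)).symm
  rw [← ofReal_norm, ENNReal.ofReal_le_ofReal_iff (by positivity), Real.norm_eq_abs] at key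
  rw [Epot, abs_mul, abs_neg, abs_of_pos (by norm_num : (0:ℝ) < 1 / 2)]
  linarith

lemma PhiHyp.nonneg {Φ Φ' : ℝ → ℝ} {n n' : ℝ} (hΦ : PhiHyp Φ Φ' n n') {s : ℝ} (hs : 0 ≤ s) :
    0 ≤ Φ s := by
  rcases hs.eq_or_lt with rfl | h
  · exact hΦ.zero.ge
  · have hd := hΦ.hasDeriv 0 (Set.mem_Ici.2 le_rfl)
    rw [hΦ.derivZero] at hd
    have := hΦ.strictConvex.convexOn.le_slope_of_hasDerivWithinAt
      (Set.mem_Ici.2 le_rfl) (Set.mem_Ici.2 hs) h hd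
    rw [slope_def_field, hΦ.zero, sub_zero, sub_zero] at this
    have h2 := mul_nonneg this h.le
    rwa [div_mul_cancel₀ _ h.ne'] at h2

lemma PhiHyp.exists_rpow_le {Φ Φ' : ℝ → ℝ} {n n' : ℝ} (hΦ : PhiHyp Φ Φ' n n') {ε : ℝ}
    (hε : 0 < ε) :
    ∃ L : ℝ, 0 ≤ L ∧ ∀ s : ℝ, 0 ≤ s → s ^ ((4:ℝ)/3) ≤ ε * Φ s + L * s := by
  obtain ⟨C, hC, r₁, hgrow⟩ := hΦ.growth
  have hδ : 0 < 1 / n - 1 / 3 := by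
    have := one_div_lt_one_div_of_lt hΦ.n_pos hΦ.n_lt_three
    linarith
  obtain ⟨s₀, hs₀⟩ := eventually_atTop.1
    ((tendsto_rpow_atTop hδ).eventually_ge_atTop (1 / (ε * C)))
  set t := max (max s₀ r₁) 1 with ht
  have ht1 : 1 ≤ t := le_max_right _ _
  refine ⟨t ^ ((1:ℝ)/3), by positivity, fun s hs => ?_⟩
  rcases hs.eq_or_lt with rfl | hpos
  · rw [hΦ.zero, zero_rpow (by norm_num)]; simp
  rcases le_total s t with hst | hts
  · have e : s ^ ((4:ℝ)/3) = s ^ ((1:ℝ)/3) * s := by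
      nth_rewrite 3 [← rpow_one s]
      rw [← rpow_add hpos]
      norm_num
    have h1 : s ^ ((1:ℝ)/3) ≤ t ^ ((1:ℝ)/3) := rpow_le_rpow hs hst (by norm_num)
    have h2 := mul_le_mul_of_nonneg_right h1 hs
    have h3 := mul_nonneg hε.le (hΦ.nonneg hs)
    linarith
  · have h1 : 1 / (ε * C) ≤ s ^ (1 / n - 1 / 3) :=
      hs₀ s (((le_max_left _ _).trans (le_max_left _ _)).trans hts)
    have h2 := hgrow s (((le_max_right _ _).trans (le_max_left _ _)).trans hts)
    have e : s ^ (1 + 1 / n) = s ^ ((4:ℝ)/3) * s ^ (1 / n - 1 / 3) := by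
      rw [← rpow_add hpos]
      congr 1; ring
    have h3 : s ^ ((4:ℝ)/3) ≤ ε * (C * s ^ (1 + 1 / n)) := by
      rw [div_le_iff₀ (by positivity)] at h1
      have h4 := mul_le_mul_of_nonneg_left h1 (rpow_nonneg hs ((4:ℝ)/3))
      rw [e]
      linarith
    have h5 := mul_le_mul_of_nonneg_left h2 hε.le
    have h6 : 0 ≤ t ^ ((1:ℝ)/3) * s := by positivity
    linarith

lemma bddBelow_HCr_image {Φ Φ' : ℝ → ℝ} {n n' : ℝ} (hΦ : PhiHyp Φ Φ' n n') {M : ℝ}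
    (hM : 0 < M) : BddBelow (HCr Φ '' FMr Φ M) := by
  obtain ⟨K, hK0, hK⟩ := exists_abs_Epot_le
  have hKM : 0 < K + M := by linarith
  obtain ⟨L, -, hL⟩ := hΦ.exists_rpow_le (inv_pos.2 hKM)
  refine ⟨-((K + M) * (L * M)), ?_⟩
  rintro _ ⟨ρ, ⟨hρ0, hρ, hΦρ, hmass⟩, rfl⟩
  have h := hK ρ (fun x => (K + M)⁻¹ * Φ (ρ x) + L * ρ x) hρ0 hρ
    ((hΦρ.const_mul _).add (hρ.const_mul _)) (fun x => hL _ (hρ0 x))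
  rw [integral_add (hΦρ.const_mul _) (hρ.const_mul _), integral_const_mul, integral_const_mul,
    hmass, mul_add, mul_inv_cancel_left₀ hKM.ne'] at h
  have := (abs_le.1 h).1
  rw [HCr]
  linarith

lemma integral_comp_smul_Space (f : Space → ℝ) {a : ℝ} (ha : 0 < a) :
    ∫ x, f (a • x) = (a ^ 3)⁻¹ * ∫ x, f x := by
  rw [Measure.integral_comp_smul, finrank_euclideanSpace, Fintype.card_fin, smul_eq_mul,
    abs_of_pos (by positivity)]

lemma Epot_comp_smul (ρ : Space → ℝ) {a : ℝ} (ha : 0 < a) :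
    Epot (fun x => ρ (a • x)) = (a ^ 5)⁻¹ * Epot ρ := by
  have h1 : ∀ x y : Space, ρ (a • x) * ρ (a • y) / ‖x - y‖ =
      a * (ρ (a • x) * ρ (a • y) / ‖a • x - a • y‖) := by
    intro x y
    rw [← smul_sub, norm_smul, Real.norm_of_nonneg ha.le, mul_div_assoc', mul_div_mul_left _ _ ha.ne']
  have h2 : ∀ x : Space, ∫ y : Space, ρ (a • x) * ρ (a • y) / ‖x - y‖ =
      a * ((a ^ 3)⁻¹ * ∫ y : Space, ρ (a • x) * ρ y / ‖a • x - y‖) := by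
    intro x
    simp_rw [h1 x]
    rw [integral_const_mul,
      integral_comp_smul_Space (fun y => ρ (a • x) * ρ y / ‖a • x - y‖) ha]
  simp only [Epot, h2]
  rw [integral_const_mul, integral_const_mul,
    integral_comp_smul_Space (fun x => ∫ y : Space, ρ x * ρ y / ‖x - y‖) ha]
  field_simp

lemma comp_smul_mem_FMr {Φ : ℝ → ℝ} {ρ : Space → ℝ} {m : ℝ} (hρ : ρ ∈ FMr Φ m) {a : ℝ}
    (ha : 0 < a) : (fun x => ρ (a • x)) ∈ FMr Φ ((a ^ 3)⁻¹ * m) := by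
  obtain ⟨h0, hi, hΦi, hm⟩ := hρ
  exact ⟨fun x => h0 _, hi.comp_smul ha.ne', hΦi.comp_smul ha.ne',
    by rw [integral_comp_smul_Space ρ ha, hm]⟩

lemma HCr_comp_smul (Φ : ℝ → ℝ) (ρ : Space → ℝ) {a : ℝ} (ha : 0 < a) :
    HCr Φ (fun x => ρ (a • x)) = (a ^ 3)⁻¹ * (∫ x, Φ (ρ x)) + (a ^ 5)⁻¹ * Epot ρ := by
  rw [HCr, Epot_comp_smul ρ ha, integral_comp_smul_Space (fun x => Φ (ρ x)) ha]

/-- For `0 < M̄ ≤ M`, `h_{M̄}^r ≥ (M̄/M)^{5/3} h_M^r`. -/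
theorem hMr_scaling (Φ Φ' : ℝ → ℝ) (n n' : ℝ) (hΦ : PhiHyp Φ Φ' n n')
    (M Mbar : ℝ) (hMbar : 0 < Mbar) (hle : Mbar ≤ M) :
    (Mbar/M) ^ ((5:ℝ)/3) * hMr Φ M ≤ hMr Φ Mbar := by
  have hM : 0 < M := hMbar.trans_le hle
  have hq : 0 < Mbar / M := div_pos hMbar hM
  set a : ℝ := (Mbar / M) ^ ((1:ℝ)/3) with hadef
  have ha : 0 < a := rpow_pos_of_pos hq _
  have ha1 : a ≤ 1 := rpow_le_one hq.le ((div_le_one hM).2 hle) (by norm_num)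
  have ha3 : a ^ 3 = Mbar / M := by
    rw [hadef, ← rpow_natCast, ← rpow_mul hq.le]; norm_num
  have ha5 : (Mbar / M) ^ ((5:ℝ)/3) = a ^ 5 := by
    rw [hadef, ← rpow_natCast, ← rpow_mul hq.le]; norm_num
  have hmass : (a ^ 3)⁻¹ * Mbar = M := by
    rw [ha3]; field_simp
  rw [ha5]
  rcases (FMr Φ Mbar).eq_empty_or_nonempty with he | hne
  · have heM : FMr Φ M = ∅ := by
      refine Set.eq_empty_of_forall_notMem fun ρ hρ => ?_
      have h := comp_smul_mem_FMr hρ (inv_pos.2 ha)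
      rw [inv_pow, inv_inv, ha3, div_mul_cancel₀ _ hM.ne', he] at h
      exact h
    simp [hMr, he, heM]
  · refine le_csInf (hne.image _) ?_
    rintro _ ⟨ρ, hρ, rfl⟩
    have hmem := comp_smul_mem_FMr hρ ha
    rw [hmass] at hmem
    have h1 : hMr Φ M ≤ HCr Φ fun x => ρ (a • x) :=
      csInf_le (bddBelow_HCr_image hΦ hM) ⟨_, hmem, rfl⟩
    have h2 := mul_le_mul_of_nonneg_left h1 (by positivity : 0 ≤ a ^ 5)
    have hI : 0 ≤ ∫ x, Φ (ρ x) := integral_nonneg fun x => hΦ.nonneg (hρ.1 x)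
    calc
      a ^ 5 * hMr Φ M ≤ a ^ 5 * ((a ^ 3)⁻¹ * (∫ x, Φ (ρ x)) + (a ^ 5)⁻¹ * Epot ρ) := by
        rwa [HCr_comp_smul Φ ρ ha] at h2
      _ = a ^ 2 * (∫ x, Φ (ρ x)) + Epot ρ := by field_simp
      _ ≤ HCr Φ ρ := by
        rw [HCr]
        gcongr
        exact mul_le_of_le_one_left hI (pow_le_one₀ ha.le ha1)
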